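/- Let ε = e^{2πi/5}, u_5(x,y) = x^8 + x^7y + 7x^6y^2 − 7x^5y^3 + 7x^3y^5 + 7x^2y^6 − xy^7 + y^8, and for k = 1,…,5 set u_k(x,y) = u_5(ε^{3k}x, ε^{2k}y). Then the second elementary symmetric function ∑_{1 ≤ j < k ≤ 5} u_j·u_k is the zero polynomial in ℂ[x,y]. -/

import Mathlib

open MvPolynomial

noncomputable def ε : ℂ := Complex.exp (2 * Real.pi * Complex.I / 5)

noncomputable def u5 : MvPolynomial (Fin 2) ℂ :=
  (X 0) ^ 8 + (X 0) ^ 7 * X 1 + 7 * (X 0) ^ 6 * (X 1) ^ 2 - 7 * (X 0) ^ 5 * (X 1) ^ 3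
    + 7 * (X 0) ^ 3 * (X 1) ^ 5 + 7 * (X 0) ^ 2 * (X 1) ^ 6 - X 0 * (X 1) ^ 7 + (X 1) ^ 8

/-- `u k` is `u5(ε^(3k) x, ε^(2k) y)`. -/
noncomputable def u (k : ℕ) : MvPolynomial (Fin 2) ℂ :=
  aeval ![C (ε ^ (3 * k)) * X 0, C (ε ^ (2 * k)) * X 1] u5

theorem isPrimitiveRoot_ε : IsPrimitiveRoot ε 5 := by
  simpa [ε] using Complex.isPrimitiveRoot_exp 5 (by norm_num)

theorem geom_sum_ε : ε ^ 4 + ε ^ 3 + ε ^ 2 + ε + 1 = 0 := by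
  have h := isPrimitiveRoot_ε.geom_sum_eq_zero (by norm_num)
  simp only [Finset.sum_range_succ, Finset.sum_range_zero] at h
  linear_combination h

/-- The decomposition of `u k` according to the residue of the exponent of `ε` modulo `5`. -/
theorem u_eq (k : ℕ) :
    u k = C ε ^ k * (X 1 ^ 8 - 7 * X 0 ^ 5 * X 1 ^ 3)
      + C ε ^ (2 * k) * (7 * X 0 ^ 6 * X 1 ^ 2 - X 0 * X 1 ^ 7)
      + C ε ^ (3 * k) * (X 0 ^ 7 * X 1 + 7 * X 0 ^ 2 * X 1 ^ 6)
      + C ε ^ (4 * k) * (X 0 ^ 8 + 7 * X 0 ^ 3 * X 1 ^ 5) := by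
  have h : ((C ε : MvPolynomial (Fin 2) ℂ) ^ k) ^ 5 = 1 := by
    rw [← pow_mul, mul_comm, pow_mul, ← C_pow, isPrimitiveRoot_ε.pow_eq_one, C_1, one_pow]
  simp only [u, u5, map_add, map_sub, map_mul, map_pow, aeval_X, map_ofNat,
    Matrix.cons_val_zero, Matrix.cons_val_one, pow_mul', mul_pow]
  generalize (C ε : MvPolynomial (Fin 2) ℂ) ^ k = t at h ⊢
  grind

/-- The second elementary symmetric function of the five conjugates of
`e a + e² b + e³ c + e⁴ d`, where `e` is a root of the fifth cyclotomic polynomial. -/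
theorem esymm2_conjugates {R : Type*} [CommRing R] {e : R}
    (he : e ^ 4 + e ^ 3 + e ^ 2 + e + 1 = 0) (a b c d : R) (w : ℕ → R)
    (hw : ∀ k, w k = e ^ k * a + e ^ (2 * k) * b + e ^ (3 * k) * c + e ^ (4 * k) * d) :
    ∑ j ∈ Finset.Icc 1 5, ∑ k ∈ Finset.Icc (j + 1) 5, w j * w k = -5 * (a * d + b * c) := by
  have h5 : e ^ 5 = 1 := by linear_combination (e - 1) * he
  have hr (n : ℕ) : e ^ n = e ^ (n % 5) := pow_eq_pow_mod n h5
  have h1 : w 1 = e * a + e ^ 2 * b + e ^ 3 * c + e ^ 4 * d := by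
    rw [hw]; norm_num
  have h2 : w 2 = e ^ 2 * a + e ^ 4 * b + e * c + e ^ 3 * d := by
    rw [hw, hr (3 * 2), hr (4 * 2)]; norm_num
  have h3 : w 3 = e ^ 3 * a + e * b + e ^ 4 * c + e ^ 2 * d := by
    rw [hw, hr (2 * 3), hr (3 * 3), hr (4 * 3)]; norm_num
  have h4 : w 4 = e ^ 4 * a + e ^ 3 * b + e ^ 2 * c + e * d := by
    rw [hw, hr (2 * 4), hr (3 * 4), hr (4 * 4)]; norm_num
  have h0 : w 5 = a + b + c + d := by
    rw [hw, hr 5, hr (2 * 5), hr (3 * 5), hr (4 * 5)]; norm_num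
  simp only [Nat.reduceAdd, Nat.reduceLeDiff, Finset.sum_Icc_succ_top, Finset.Icc_self,
    Finset.sum_singleton, Finset.Icc_eq_empty_of_lt, Nat.reduceLT, Finset.sum_empty,
    h0, h1, h2, h3, h4]
  linear_combination ((e ^ 3 + e) * (a ^ 2 + b ^ 2 + c ^ 2 + d ^ 2)
    + (e ^ 4 + e ^ 2 + 2 * e) * (a * b + a * c + b * d + c * d)
    + (e ^ 4 + e ^ 3 + e ^ 2 - 3 * e + 5) * (a * d + b * c)) * he

theorem esymm2_u_eq_zero :
    ∑ j ∈ Finset.Icc 1 5, ∑ k ∈ Finset.Icc (j + 1) 5, u j * u k = 0 := by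
  have he : (C ε : MvPolynomial (Fin 2) ℂ) ^ 4 + C ε ^ 3 + C ε ^ 2 + C ε + 1 = 0 := by
    simpa using congrArg (C : ℂ →+* MvPolynomial (Fin 2) ℂ) geom_sum_ε
  rw [esymm2_conjugates he _ _ _ _ u u_eq]
  ring
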